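/- arXiv:2101.02735 — 2 statements merged into one kernel-verified Lean document; each statement's English description precedes it below -/
import Mathlib

section
/- Let f, g be homogeneous forms in R = K[x_1,…,x_n] of degrees d and e, with gcd(f,g) = 1, char(K) dividing neither e nor d+e. Set F = fg. If (P_1,…,P_n) is a nonzero homogeneous syzygy of the partial derivatives of F (i.e., Σ P_i F_{x_i} = 0), then deg(P_i) ≥ indeg(Syz(J_g)), the initial degree of the syzygy module of the partial derivatives of g. In particular, if J_g is a complete intersection (g smooth) then indeg(Syz(J_F)) ≥ e − 1. -/
open MvPolynomial Finset

/-- If `g` and `g * k` are homogeneous and `g ≠ 0`, then so is `k`. -/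
theorem MvPolynomial.IsHomogeneous.of_mul_left {σ R : Type*} [CommRing R] [IsDomain R]
    {g k : MvPolynomial σ R} {e p : ℕ} (hg : g.IsHomogeneous e) (hg0 : g ≠ 0)
    (h : (g * k).IsHomogeneous (e + p)) : k.IsHomogeneous p := by
  let _ : GradedAlgebra (homogeneousSubmodule σ R) := gradedAlgebra
  have key := DirectSum.coe_decompose_mul_add_of_left_mem (homogeneousSubmodule σ R)
    (i := e) (j := p) (b := k) hg
  rw [DirectSum.decompose_of_mem_same _ h] at key
  rw [mul_left_cancel₀ hg0 key]
  exact (DirectSum.decompose (homogeneousSubmodule σ R) k p).2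

theorem MvPolynomial.IsHomogeneous.not_isUnit {σ R : Type*} [CommRing R] [Nontrivial R]
    {g : MvPolynomial σ R} {e : ℕ} (hg : g.IsHomogeneous e) (he : e ≠ 0) : ¬ IsUnit g := by
  intro hu
  have h0 : constantCoeff g = 0 := hg.coeff_eq_zero (d := 0) (by simpa using he.symm)
  exact not_isUnit_zero (h0 ▸ hu.map constantCoeff)

theorem stmt11 {K : Type*} [Field K] [Infinite K] {n d e : ℕ}
    (he : (e : K) ≠ 0) (hde : ((d + e : ℕ) : K) ≠ 0)
    (f g : MvPolynomial (Fin n) K)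
    (hf : f.IsHomogeneous d) (hg : g.IsHomogeneous e)
    (hcop : IsRelPrime f g)
    (p : ℕ) (P : Fin n → MvPolynomial (Fin n) K)
    (hP : ∀ i, (P i).IsHomogeneous p) (hPne : P ≠ 0)
    (hsyz : ∑ i, P i * pderiv i (f * g) = 0) :
    ∃ q ≤ p, ∃ Q : Fin n → MvPolynomial (Fin n) K,
      Q ≠ 0 ∧ (∀ i, (Q i).IsHomogeneous q) ∧ ∑ i, Q i * pderiv i g = 0 := by
  refine ⟨p, le_rfl, ?_⟩
  rcases eq_or_ne g 0 with rfl | hg0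
  · exact ⟨P, hPne, hP, by simp⟩
  have he0 : e ≠ 0 := by rintro rfl; simp at he
  have hf0 : f ≠ 0 := by
    rintro rfl
    exact hg.not_isUnit he0 (hcop (dvd_zero g) dvd_rfl)
  have hsum : f * ∑ i, P i * pderiv i g = -(g * ∑ i, P i * pderiv i f) := by
    rw [← sub_eq_zero, ← hsyz, sub_neg_eq_add, mul_sum, mul_sum, ← sum_add_distrib]
    refine sum_congr rfl fun i _ => ?_
    rw [Derivation.leibniz, smul_eq_mul, smul_eq_mul]
    ring
  obtain ⟨h, hh⟩ : g ∣ ∑ i, P i * pderiv i g :=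
    hcop.symm.dvd_of_dvd_mul_left (hsum ▸ (dvd_mul_right g _).neg_right)
  have hhX (i : Fin n) : (h * X i).IsHomogeneous p := by
    refine hg.of_mul_left hg0 ?_
    rw [← mul_assoc, ← hh, show e + p = p + (e - 1) + 1 by omega]
    exact (IsHomogeneous.sum _ _ _ fun j _ => (hP j).mul hg.pderiv).mul (isHomogeneous_X K i)
  have euler {φ : MvPolynomial (Fin n) K} {m : ℕ} (hφ : φ.IsHomogeneous m) :
      ∑ i, C (e : K)⁻¹ * (h * X i) * pderiv i φ = C ((e : K)⁻¹ * m) * (h * φ) := by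
    have := hφ.sum_X_mul_pderiv
    simp_rw [mul_assoc, ← mul_sum, this, nsmul_eq_mul, C_mul, map_natCast]
    ring
  refine ⟨fun i => P i - C (e : K)⁻¹ * (h * X i), fun hQ => ?_,
    fun i => (hP i).sub ((hhX i).C_mul _), ?_⟩
  · have hPi (i : Fin n) : P i = C (e : K)⁻¹ * (h * X i) := sub_eq_zero.mp (congrFun hQ i)
    have hF := euler (hf.mul hg)
    simp_rw [← hPi] at hF
    rw [hsyz, eq_comm, mul_eq_zero, C_eq_zero] at hF
    have hh0 : h = 0 := by
      simpa [he, hf0, hg0, -Nat.cast_add, hde] using hF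
    exact hPne (funext fun i => by simp [hPi i, hh0])
  · simp_rw [sub_mul, sum_sub_distrib]
    rw [euler hg, hh, inv_mul_cancel₀ he, C_1]
    ring
end

section
/- Let f_1,…,f_m (m ≥ 2) be pairwise coprime homogeneous forms in R = K[x_1,…,x_n] of degrees d_1,…,d_m ≥ 2, char(K) = 0, and set F = f_1⋯f_m. Then the initial degree of the syzygy module of the partial derivatives of F satisfies indeg(Syz(J_F)) ≥ ⌊(d_1+⋯+d_m)/m⌋ − 1, assuming each f_i is smooth (J_{f_i} is m-primary). -/
open MvPolynomial Finset

open CliffordAlgebra in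
/-- The image of the Koszul differential of `φ` lies in `I • ⋀ M` when `φ` takes values in `I`. -/
theorem ExteriorAlgebra.contractLeft_mem_smul_top {R M : Type*} [CommRing R] [AddCommGroup M]
    [Module R M] (φ : Module.Dual R M) {I : Ideal R} (hI : ∀ v, φ v ∈ I)
    (x : ExteriorAlgebra R M) :
    contractLeft (Q := (0 : QuadraticForm R M)) φ x ∈
      (I • ⊤ : Submodule R (ExteriorAlgebra R M)) := by
  induction x using CliffordAlgebra.left_induction with
  | algebraMap r => rw [contractLeft_algebraMap]; exact zero_mem _
  | add x y hx hy => rw [map_add]; exact add_mem hx hy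
  | ι_mul x v hx =>
    rw [contractLeft_ι_mul]
    refine sub_mem (Submodule.smul_mem_smul (hI v) trivial) ?_
    exact Submodule.smul_top_le_comap_smul_top I (LinearMap.mulLeft R (CliffordAlgebra.ι 0 v)) hx

/-- Multiplication by `r` on a free module reflects membership in `J • ⊤` if it does so on `R`. -/
theorem Module.Free.mem_smul_top_of_smul_mem {R M : Type*} [CommRing R] [AddCommGroup M]
    [Module R M] [Module.Free R M] {J : Ideal R} {r : R} (hr : ∀ x, r * x ∈ J → x ∈ J) {x : M}
    (hx : r • x ∈ (J • ⊤ : Submodule R M)) : x ∈ (J • ⊤ : Submodule R M) := by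
  obtain ⟨ι, b⟩ := Module.Free.exists_basis R M
  have key (y : M) (hy : y ∈ (J • ⊤ : Submodule R M)) (i : ι) : b.repr y i ∈ J := by
    simpa using Submodule.smul_top_le_comap_smul_top J (b.coord i) hy
  rw [← b.linearCombination_repr x]
  refine Submodule.sum_mem _ fun i _ => Submodule.smul_mem_smul (hr _ ?_) trivial
  simpa using key _ hx i

theorem exteriorPower.eq_zero_of_finrank_lt {R M : Type*} [CommRing R] [Nontrivial R]
    [AddCommGroup M] [Module R M] [Module.Free R M] [Module.Finite R M] {i : ℕ}
    (hi : Module.finrank R M < i) {x : ExteriorAlgebra R M} (hx : x ∈ ⋀[R]^i M) : x = 0 := by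
  have h : Module.finrank R (⋀[R]^i M) = 0 := by
    rw [exteriorPower.finrank_eq, Nat.choose_eq_zero_of_lt hi]
  have := Module.finrank_eq_zero_iff_of_free R _ |>.mp h
  exact congrArg Subtype.val (Subsingleton.elim (⟨x, hx⟩ : ⋀[R]^i M) 0)

open CliffordAlgebra in
/-- Depth sensitivity of the Koszul complex: if `φ v₀, φ v₁, …` is a regular sequence whose length
is the rank of `M`, then the Koszul complex of `φ` modulo the first `s` terms of the sequence is
exact in degrees larger than `s`. -/
theorem ExteriorAlgebra.exists_sub_contractLeft_mem {R M : Type*} [CommRing R] [Nontrivial R]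
    [AddCommGroup M] [Module R M] [Module.Free R M] [Module.Finite R M] (φ : Module.Dual R M)
    (J : ℕ → Ideal R) (v : ℕ → M) (hJ : ∀ s, J (s + 1) = J s ⊔ Ideal.span {φ (v s)})
    (hreg : ∀ s < Module.finrank R M, ∀ x, φ (v s) * x ∈ J s → x ∈ J s)
    {s : ℕ} (hs : s ≤ Module.finrank R M) :
    ∀ i > s, ∀ w ∈ ⋀[R]^i M,
      contractLeft (Q := (0 : QuadraticForm R M)) φ w ∈
        (J s • ⊤ : Submodule R (ExteriorAlgebra R M)) →
      ∃ z : ExteriorAlgebra R M, w - contractLeft (Q := (0 : QuadraticForm R M)) φ z ∈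
        (J s • ⊤ : Submodule R (ExteriorAlgebra R M)) := by
  have : Module.Free R (ExteriorAlgebra R M) := by
    classical
    let : LinearOrder (Module.Free.ChooseBasisIndex R M) := linearOrderOfSTO WellOrderingRel
    exact Module.Free.of_basis (Module.Free.chooseBasis R M).ExteriorAlgebra
  induction hs using Nat.decreasingInduction with
  | self =>
    intro i hi w hw _
    refine ⟨0, ?_⟩
    rw [exteriorPower.eq_zero_of_finrank_lt hi hw, map_zero, sub_zero]
    exact zero_mem _
  | of_succ s hs ih =>
    intro i hi w hw hdw
    set d := contractLeft (Q := (0 : QuadraticForm R M)) φ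
    have hd_smul (I : Ideal R) {x : ExteriorAlgebra R M}
        (hx : x ∈ (I • ⊤ : Submodule R (ExteriorAlgebra R M))) :
        d x ∈ (I • ⊤ : Submodule R (ExteriorAlgebra R M)) := by
      exact Submodule.smul_top_le_comap_smul_top I d hx
    have hmul_smul (I : Ideal R) (u : M) {x : ExteriorAlgebra R M}
        (hx : x ∈ (I • ⊤ : Submodule R (ExteriorAlgebra R M))) :
        ExteriorAlgebra.ι R u * x ∈ (I • ⊤ : Submodule R (ExteriorAlgebra R M)) := by
      exact Submodule.smul_top_le_comap_smul_top I (LinearMap.mulLeft R (ExteriorAlgebra.ι R u)) hx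
    have hwedge : d (ExteriorAlgebra.ι R (v s) * w)
        = φ (v s) • w - ExteriorAlgebra.ι R (v s) * d w := contractLeft_ι_mul ..
    have hle : (J s • ⊤ : Submodule R (ExteriorAlgebra R M)) ≤ J (s + 1) • ⊤ :=
      Submodule.smul_mono_left (hJ s ▸ le_sup_left)
    have hmem : φ (v s) ∈ J (s + 1) :=
      hJ s ▸ Ideal.mem_sup_right (Ideal.mem_span_singleton_self _)
    obtain ⟨z, hz⟩ := ih (i + 1) (by omega) (ExteriorAlgebra.ι R (v s) * w)
      (by rw [ExteriorAlgebra.exteriorPower, pow_succ']; exact Submodule.mul_mem_mul ⟨_, rfl⟩ hw)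
      (by
        rw [hwedge]
        exact sub_mem (Submodule.smul_mem_smul hmem trivial) (hle (hmul_smul _ _ hdw)))
    rw [hJ s, Submodule.sup_smul, Submodule.mem_sup] at hz
    obtain ⟨y, hy, t, ht, hyt⟩ := hz
    rw [Submodule.ideal_span_singleton_smul] at ht
    obtain ⟨u, -, hu⟩ := ht
    change φ (v s) • u = t at hu
    rw [← hu] at hyt
    refine ⟨u, Module.Free.mem_smul_top_of_smul_mem (hreg s hs) ?_⟩
    have hddz : d (d z) = 0 := contractLeft_contractLeft ..
    have e := congrArg d hyt
    rw [map_add, map_sub, hwedge, map_smul, hddz, sub_zero] at e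
    have : φ (v s) • (w - d u) = d y + ExteriorAlgebra.ι R (v s) * d w := by
      rw [smul_sub, sub_eq_iff_eq_add, add_right_comm, e, sub_add_cancel]
    rw [this]
    exact add_mem (hd_smul _ hy) (hmul_smul _ _ hdw)

/-- If the ideal generated by `g₀, …, gₙ₋₁` contains a regular sequence of length `n`, then all
syzygies of `g` have entries in this ideal. -/
theorem Ideal.mem_span_range_of_sum_mul_eq_zero {R : Type*} [CommRing R] [Nontrivial R] {n : ℕ}
    (g : Fin n → R) (a : ℕ → R) (ha : ∀ s, a s ∈ Ideal.span (Set.range g)) (J : ℕ → Ideal R)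
    (hJ0 : J 0 = ⊥) (hJ : ∀ s, J (s + 1) = J s ⊔ Ideal.span {a s})
    (hreg : ∀ s < n, ∀ x, a s * x ∈ J s → x ∈ J s)
    (q : Fin n → R) (hq : ∑ k, q k * g k = 0) (k : Fin n) : q k ∈ Ideal.span (Set.range g) := by
  let φ : Module.Dual R (Fin n → R) := Fintype.linearCombination R g
  have hφ (x : Fin n → R) : φ x = ∑ k, x k * g k := by
    simp [φ, Fintype.linearCombination_apply]
  have hφI (x : Fin n → R) : φ x ∈ Ideal.span (Set.range g) := by
    rw [hφ]
    exact Submodule.sum_mem _ fun k _ => Ideal.mul_mem_left _ _ (Ideal.subset_span (Set.mem_range_self k))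
  have hv (s : ℕ) : ∃ v, φ v = a s := by
    obtain ⟨v, hv⟩ := Ideal.mem_span_range_iff_exists_fun.mp (ha s)
    exact ⟨v, (hφ v).trans hv⟩
  choose v hv using hv
  have hq1 : ExteriorAlgebra.ι R q ∈ ⋀[R]^1 (Fin n → R) := by
    rw [ExteriorAlgebra.exteriorPower, pow_one]
    exact ⟨q, rfl⟩
  obtain ⟨z, hz⟩ := ExteriorAlgebra.exists_sub_contractLeft_mem φ J v (by simpa [hv] using hJ)
    (by simpa [hv] using hreg) (Nat.zero_le _) 1 one_pos (ExteriorAlgebra.ι R q) hq1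
    (by
      have : CliffordAlgebra.contractLeft (Q := (0 : QuadraticForm R (Fin n → R))) φ
          (ExteriorAlgebra.ι R q) = algebraMap R _ (φ q) := CliffordAlgebra.contractLeft_ι ..
      rw [this, hφ, hq, map_zero]
      exact zero_mem _)
  rw [hJ0, Submodule.bot_smul, Submodule.mem_bot, sub_eq_zero] at hz
  have hmem := ExteriorAlgebra.contractLeft_mem_smul_top φ hφI z
  rw [← hz] at hmem
  simpa [ExteriorAlgebra.ι_leftInverse q] using
    Submodule.smul_top_le_comap_smul_top _ (LinearMap.proj k ∘ₗ ExteriorAlgebra.ιInv) hmem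

/-- Powers of distinct variables form a regular sequence. -/
theorem MvPolynomial.mem_span_X_pow_of_X_pow_mul_mem {σ K : Type*} [CommRing K]
    (N : σ → ℕ) {S : Set σ} {i : σ} (hi : i ∉ S) {x : MvPolynomial σ K}
    (hx : X i ^ N i * x ∈ Ideal.span ((fun j => (X j ^ N j : MvPolynomial σ K)) '' S)) :
    x ∈ Ideal.span ((fun j => (X j ^ N j : MvPolynomial σ K)) '' S) := by
  have hS : (fun j => (X j ^ N j : MvPolynomial σ K)) '' S
      = (fun s => monomial s (1 : K)) '' ((fun j => Finsupp.single j (N j)) '' S) := by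
    rw [Set.image_image]
    simp only [X_pow_eq_monomial]
  rw [hS, mem_ideal_span_monomial_image] at hx ⊢
  intro t ht
  obtain ⟨_, ⟨j, hj, rfl⟩, hle⟩ := hx (Finsupp.single i (N i) + t) (by
    rw [mem_support_iff, X_pow_eq_monomial, coeff_monomial_mul, one_mul]
    exact mem_support_iff.mp ht)
  refine ⟨_, ⟨j, hj, rfl⟩, ?_⟩
  rw [Finsupp.single_le_iff] at hle ⊢
  have hij : i ≠ j := fun h => hi (h ▸ hj)
  simpa [Finsupp.single_apply, hij] using hle

/-- Syzygies of `n` polynomials in `n` variables generating an ideal with radical `(X₀, …, Xₙ₋₁)`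
have entries in that ideal. -/
theorem MvPolynomial.syzygy_mem_span {K : Type*} [Field K] {n : ℕ}
    (g : Fin n → MvPolynomial (Fin n) K)
    (hg : ∀ k, X k ∈ (Ideal.span (Set.range g)).radical)
    (q : Fin n → MvPolynomial (Fin n) K) (hq : ∑ k, q k * g k = 0) (k : Fin n) :
    q k ∈ Ideal.span (Set.range g) := by
  choose N hN using hg
  let J (s : ℕ) : Ideal (MvPolynomial (Fin n) K) :=
    Ideal.span ((fun j => X j ^ N j) '' {j : Fin n | j.val < s})
  refine Ideal.mem_span_range_of_sum_mul_eq_zero g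
    (fun s => if h : s < n then X ⟨s, h⟩ ^ N ⟨s, h⟩ else 0) (fun s => ?_) J ?_ (fun s => ?_)
    (fun s hs x hx => ?_) q hq k
  · split_ifs
    · exact hN _
    · exact zero_mem _
  · simp [J]
  · by_cases h : s < n
    · have : {j : Fin n | j.val < s + 1} = {j : Fin n | j.val < s} ∪ {⟨s, h⟩} := by
        ext j
        simp [Fin.ext_iff, le_iff_eq_or_lt]
      simp only [J, this, Set.image_union, Set.image_singleton, Ideal.span_union, h, dif_pos]
    · have : {j : Fin n | j.val < s + 1} = {j : Fin n | j.val < s} := by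
        ext j
        have := j.isLt
        simp only [Set.mem_ofPred_eq]
        omega
      simp only [J, this, h, dif_neg, not_false_eq_true, Ideal.span_singleton_zero, sup_bot_eq]
  · simp only [hs, dif_pos] at hx
    exact mem_span_X_pow_of_X_pow_mul_mem N (by simp) hx

/-- An ideal generated by forms of degree `e` has no components in degree less than `e`. -/
theorem MvPolynomial.homogeneousComponent_eq_zero_of_mem_span {σ ι K : Type*} [Fintype ι]
    [CommRing K] {e p : ℕ} (hp : p < e) {g : ι → MvPolynomial σ K}
    (hg : ∀ k, (g k).IsHomogeneous e) {x : MvPolynomial σ K}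
    (hx : x ∈ Ideal.span (Set.range g)) : homogeneousComponent p x = 0 := by
  obtain ⟨c, rfl⟩ := Ideal.mem_span_range_iff_exists_fun.mp hx
  rw [map_sum]
  refine sum_eq_zero fun k _ => ?_
  rw [← sum_homogeneousComponent (c k), sum_mul, map_sum]
  refine sum_eq_zero fun j _ => ?_
  rw [homogeneousComponent_of_mem (((homogeneousComponent_isHomogeneous j (c k)).mul (hg k))),
    if_neg (by omega)]

theorem MvPolynomial.exists_homogeneousComponent_mul_X {σ K : Type*} [CommRing K]
    (p : ℕ) (h : MvPolynomial σ K) :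
    ∃ u : MvPolynomial σ K, ∀ k, homogeneousComponent p (h * X k) = u * X k := by
  refine ⟨if p = 0 then 0 else homogeneousComponent (p - 1) h, fun k => ?_⟩
  conv_lhs => rw [← sum_homogeneousComponent h, sum_mul, map_sum]
  have hc (j : ℕ) : homogeneousComponent p (homogeneousComponent j h * X k)
      = if p = j + 1 then homogeneousComponent j h * X k else 0 :=
    homogeneousComponent_of_mem
      ((homogeneousComponent_isHomogeneous j h).mul (isHomogeneous_X K k))
  simp only [hc]
  rcases p with _ | p
  · simp
  · simp only [add_left_inj, sum_ite_eq, mem_range, Nat.add_eq_zero_iff, one_ne_zero, and_false,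
      if_false, Nat.add_sub_cancel]
    split_ifs with hp
    · rfl
    · rw [homogeneousComponent_eq_zero _ _ (by omega), zero_mul]

/-- A derivation of low degree preserving the ideal of a smooth form is a multiple of the Euler
derivation. -/
theorem MvPolynomial.exists_eq_mul_X_of_dvd {K : Type*} [Field K] [CharZero K] {n d p : ℕ}
    (hpd : p < d - 1) {f : MvPolynomial (Fin n) K} (hf : f.IsHomogeneous d)
    (hsm : ∀ k, X k ∈ (Ideal.span (Set.range fun k => pderiv k f)).radical)
    {P : Fin n → MvPolynomial (Fin n) K} (hP : ∀ i, (P i).IsHomogeneous p)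
    (hdvd : f ∣ ∑ i, P i * pderiv i f) : ∃ u, ∀ k, P k = u * X k := by
  obtain ⟨h, hh⟩ := hdvd
  have hd0 : (d : K) ≠ 0 := Nat.cast_ne_zero.mpr (by omega)
  obtain ⟨u, hu⟩ := exists_homogeneousComponent_mul_X p h
  refine ⟨C (d : K)⁻¹ * u, fun k => ?_⟩
  have hq := syzygy_mem_span (fun k => pderiv k f) hsm (fun k => C (d : K) * P k - h * X k) (by
    simp only [sub_mul, sum_sub_distrib, mul_assoc, ← mul_sum]
    rw [hh, hf.sum_X_mul_pderiv, nsmul_eq_mul, map_natCast]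
    ring) k
  have hq := homogeneousComponent_eq_zero_of_mem_span hpd (fun k => hf.pderiv) hq
  rw [map_sub, hu, homogeneousComponent_C_mul, homogeneousComponent_of_mem (hP k), if_pos rfl,
    sub_eq_zero] at hq
  rw [mul_assoc, ← hq, ← mul_assoc, ← C_mul, inv_mul_cancel₀ hd0, C_1, one_mul]

theorem MvPolynomial.dvd_sum_mul_pderiv_of_prod {K ι : Type*} [Field K] [Fintype ι]
    [DecidableEq ι] {n : ℕ} {f : ι → MvPolynomial (Fin n) K}
    (hcop : ∀ i j, i ≠ j → IsRelPrime (f i) (f j)) {P : Fin n → MvPolynomial (Fin n) K}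
    (hsyz : ∑ k, P k * pderiv k (∏ j, f j) = 0) (i : ι) :
    f i ∣ ∑ k, P k * pderiv k (f i) := by
  have hrel : IsRelPrime (f i) (∏ j ∈ univ.erase i, f j) :=
    IsRelPrime.prod_right fun j hj => hcop i j (ne_of_mem_erase hj).symm
  refine hrel.dvd_of_dvd_mul_right ⟨-∑ k, P k * pderiv k (∏ j ∈ univ.erase i, f j), ?_⟩
  rw [mul_neg, eq_neg_iff_add_eq_zero, sum_mul, mul_sum, ← sum_add_distrib, ← hsyz]
  refine sum_congr rfl fun k _ => ?_
  rw [← mul_prod_erase univ f (mem_univ i), Derivation.leibniz, smul_eq_mul, smul_eq_mul]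
  ring

theorem stmt14 {K : Type*} [Field K] [Infinite K] [CharZero K] {n m : ℕ}
    (hm : 2 ≤ m)
    (f : Fin m → MvPolynomial (Fin n) K) (d : Fin m → ℕ)
    (hd : ∀ i, 2 ≤ d i)
    (hf : ∀ i, (f i).IsHomogeneous (d i))
    (hcop : ∀ i j, i ≠ j → IsRelPrime (f i) (f j))
    (hsm : ∀ i, (Ideal.span (Set.range fun k => pderiv k (f i))).radical =
      Ideal.span (Set.range (X : Fin n → MvPolynomial (Fin n) K)))
    (p : ℕ) (P : Fin n → MvPolynomial (Fin n) K)
    (hP : ∀ i, (P i).IsHomogeneous p) (hPne : P ≠ 0)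
    (hsyz : ∑ i, P i * pderiv i (∏ j, f j) = 0) :
    (∑ i, d i) / m - 1 ≤ p := by
  by_contra! hlt
  obtain ⟨k₀, -⟩ := Function.ne_iff.mp hPne
  have hX (i : Fin m) (k : Fin n) :
      X k ∈ (Ideal.span (Set.range fun k => pderiv k (f i))).radical :=
    hsm i ▸ Ideal.subset_span ⟨k, rfl⟩
  have hf0 (i : Fin m) : f i ≠ 0 := by
    intro h
    obtain ⟨N, hN⟩ := hX i k₀
    have hbot : Ideal.span (Set.range fun k => pderiv k (f i)) = ⊥ := by
      simp [h]
    rw [hbot, Ideal.mem_bot] at hN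
    exact X_ne_zero k₀ (eq_zero_of_pow_eq_zero hN)
  obtain ⟨i, hi⟩ : ∃ i, (∑ i, d i) / m ≤ d i := by
    have : Nonempty (Fin m) := ⟨⟨0, by omega⟩⟩
    by_contra! h
    have := sum_lt_sum_of_nonempty univ_nonempty fun i _ => h i
    rw [sum_const, card_univ, Fintype.card_fin, smul_eq_mul] at this
    exact absurd (Nat.mul_div_le (∑ i, d i) m) (by omega)
  obtain ⟨u, hu⟩ := exists_eq_mul_X_of_dvd (by omega) (hf i) (hX i) hP
    (dvd_sum_mul_pderiv_of_prod hcop hsyz i)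
  have hF : (∏ j, f j).IsHomogeneous (∑ j, d j) := IsHomogeneous.prod _ _ _ fun j _ => hf j
  have hdeg : ∑ j, d j ≠ 0 := fun h => by
    have := sum_eq_zero_iff.mp h i (mem_univ i)
    have := hd i
    omega
  have hu0 : u = 0 := by
    simp only [hu, mul_assoc, ← mul_sum] at hsyz
    rw [hF.sum_X_mul_pderiv, mul_eq_zero, smul_eq_zero] at hsyz
    simpa [hdeg, prod_eq_zero_iff, hf0] using hsyz
  exact hPne (funext fun k => by rw [hu k, hu0, zero_mul, Pi.zero_apply])
end
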